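/- arXiv:2605.26980 — 6 statements merged into one kernel-verified Lean document; each statement's English description precedes it below -/
import Mathlib

section
/- Let E be a finite-dimensional real normed vector space, let r ≥ 2 be an integer, and let F : E × ℝ → ℝ be a C^r function which is 1-periodic in its second variable (F(x,t+1) = F(x,t) for all x,t). Suppose that for every x ∈ E there exists t_x ∈ ℝ, unique modulo 1, such that F(x,t_x) = sup_{t ∈ ℝ} F(x,t), and that the second derivative of the map t ↦ F(x,t) at t_x is strictly negative. Then the function f_F : E → ℝ given by f_F(x) = sup_{t ∈ ℝ} F(x,t) is of class C^{r−1}. -/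
/-- The derivative of a slice `t ↦ F (x, t)` is the Fréchet derivative in the direction `(0, 1)`. -/
theorem DifferentiableAt.hasDerivAt_slice {E G : Type*} [NormedAddCommGroup E] [NormedSpace ℝ E]
    [NormedAddCommGroup G] [NormedSpace ℝ G] {F : E × ℝ → G} {x : E} {t : ℝ}
    (hF : DifferentiableAt ℝ F (x, t)) :
    HasDerivAt (fun s : ℝ => F (x, s)) (fderiv ℝ F (x, t) (0, 1)) t :=
  hF.hasFDerivAt.comp_hasDerivAt t ((hasDerivAt_const t x).prodMk (hasDerivAt_id t))

/-- A nonzero multiple of the identity of `ℝ` is invertible. -/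
theorem ContinuousLinearMap.isInvertible_of_apply_one_ne_zero {L : ℝ →L[ℝ] ℝ} (hL : L 1 ≠ 0) :
    L.IsInvertible := by
  refine ⟨ContinuousLinearEquiv.unitsEquivAut ℝ (Units.mk0 (L 1) hL), ?_⟩
  ext
  simp

open Filter Topology in
/-- If a continuous function, `1`-periodic in `t`, has at `x₀` a maximizer `t₀` unique modulo `1`,
and maximizers exist for each `x`, then for `x` near `x₀` there is a maximizer close to `t₀`. -/
theorem eventually_exists_maximizer_near {X : Type*} [TopologicalSpace X] {F : X × ℝ → ℝ}
    (hF : Continuous F) (hper : ∀ (x : X) (t : ℝ), F (x, t + 1) = F (x, t))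
    (hmax : ∀ x : X, ∃ t : ℝ, ∀ s : ℝ, F (x, s) ≤ F (x, t)) {x₀ : X} {t₀ : ℝ}
    (ht₀ : ∀ s : ℝ, F (x₀, s) ≤ F (x₀, t₀))
    (huniq : ∀ t : ℝ, (∀ s : ℝ, F (x₀, s) ≤ F (x₀, t)) → ∃ k : ℤ, t - t₀ = (k : ℝ))
    {V : Set ℝ} (hV : V ∈ 𝓝 t₀) :
    ∀ᶠ x in 𝓝 x₀, ∃ t ∈ V, ∀ s : ℝ, F (x, s) ≤ F (x, t) := by
  have hK : IsCompact (Set.Icc (t₀ - 1 / 2) (t₀ + 1 / 2) \ interior V) :=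
    isCompact_Icc.diff isOpen_interior
  have hlt : ∀ t ∈ Set.Icc (t₀ - 1 / 2) (t₀ + 1 / 2) \ interior V,
      ∀ᶠ z : X × ℝ in 𝓝 (x₀, t), F z < F (z.1, t₀) := by
    rintro t ⟨ht, htV⟩
    have hne : F (x₀, t) < F (x₀, t₀) := by
      refine (ht₀ t).lt_of_ne fun heq => htV ?_
      obtain ⟨k, hk⟩ := huniq t fun s => heq ▸ ht₀ s
      have hk1 : (k : ℝ) < 1 := by linarith [ht.2]
      have hk2 : (-1 : ℝ) < k := by linarith [ht.1]
      have hk0 : k = 0 := by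
        have h1 : k < 1 := by exact_mod_cast hk1
        have h2 : -1 < k := by exact_mod_cast hk2
        omega
      have : t = t₀ := by simpa [hk0, sub_eq_zero] using hk
      exact this ▸ mem_interior_iff_mem_nhds.2 hV
    exact (isOpen_lt hF (by fun_prop)).mem_nhds hne
  filter_upwards [hK.eventually_forall_of_forall_eventually
    (P := fun x t => F (x, t) < F (x, t₀)) hlt] with x hx
  obtain ⟨t, ht⟩ := hmax x
  have hperiodic : Function.Periodic (fun s => F (x, s)) 1 := hper x
  obtain ⟨t', ht', heq⟩ := hperiodic.exists_mem_Ico one_pos t (t₀ - 1 / 2)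
  change F (x, t) = F (x, t') at heq
  refine ⟨t', ?_, fun s => heq ▸ ht s⟩
  by_contra htV
  exact (hx t' ⟨⟨ht'.1, by linarith [ht'.2]⟩, fun h => htV (interior_subset h)⟩).not_ge
    (heq ▸ ht t₀)

/-- If `F : E × ℝ → ℝ` is `C^r` (`r ≥ 2`), `1`-periodic in the second variable, and for each `x`
the map `t ↦ F (x, t)` has a maximizer `tx`, unique modulo `1`, at which its second derivative
is strictly negative, then `x ↦ sup_t F (x, t)` is of class `C^{r-1}`. -/
theorem stmt1 {E : Type*} [NormedAddCommGroup E] [NormedSpace ℝ E] [FiniteDimensional ℝ E]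
    (r : ℕ) (hr : 2 ≤ r) (F : E × ℝ → ℝ) (hF : ContDiff ℝ r F)
    (hper : ∀ (x : E) (t : ℝ), F (x, t + 1) = F (x, t))
    (hmax : ∀ x : E, ∃ tx : ℝ,
      (∀ t : ℝ, F (x, t) ≤ F (x, tx)) ∧
      (∀ t : ℝ, (∀ s : ℝ, F (x, s) ≤ F (x, t)) → ∃ k : ℤ, t - tx = (k : ℝ)) ∧
      deriv (deriv fun t : ℝ => F (x, t)) tx < 0) :
    ContDiff ℝ ((r - 1 : ℕ) : ℕ∞) (fun x : E => ⨆ t : ℝ, F (x, t)) := by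
  have : CompleteSpace E := FiniteDimensional.complete ℝ E
  have hn : ((((r - 1 : ℕ) : ℕ∞) : WithTop ℕ∞)) ≠ 0 := by
    exact_mod_cast (by omega : r - 1 ≠ 0)
  have hn_succ : ((((r - 1 : ℕ) : ℕ∞) : WithTop ℕ∞)) + 1 ≤ (r : WithTop ℕ∞) := by
    exact_mod_cast (by omega : r - 1 + 1 ≤ r)
  have hFn : ContDiff ℝ ((r - 1 : ℕ) : ℕ∞) F := hF.of_le (le_self_add.trans hn_succ)
  let G : E × ℝ → ℝ := fun z => fderiv ℝ F z (0, 1)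
  have hG : ContDiff ℝ ((r - 1 : ℕ) : ℕ∞) G := (hF.fderiv_right hn_succ).clm_apply contDiff_const
  have hderiv (x : E) (t : ℝ) : HasDerivAt (fun s => F (x, s)) (G (x, t)) t :=
    (hFn.differentiable hn _).hasDerivAt_slice
  have hcrit (x : E) (t : ℝ) (h : ∀ s, F (x, s) ≤ F (x, t)) : G (x, t) = 0 :=
    IsLocalMax.hasDerivAt_eq_zero (f := fun s => F (x, s)) (Filter.Eventually.of_forall h) (hderiv x t)
  refine contDiff_iff_contDiffAt.2 fun x₀ => ?_
  obtain ⟨t₀, ht₀, huniq, hneg⟩ := hmax x₀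
  have hinv : (fderiv ℝ G (x₀, t₀) ∘L .inr ℝ E ℝ).IsInvertible := by
    apply ContinuousLinearMap.isInvertible_of_apply_one_ne_zero
    rw [funext fun t => (hderiv x₀ t).deriv,
      (hG.differentiable hn (x₀, t₀)).hasDerivAt_slice.deriv] at hneg
    simpa using hneg.ne
  have hGx := hG.contDiffAt (x := (x₀, t₀))
  let ψ := hGx.implicitFunction hn hinv
  have hψ : ContDiffAt ℝ ((r - 1 : ℕ) : ℕ∞) ψ x₀ := hGx.contDiffAt_implicitFunction hn hinv
  have hiff := hGx.eventually_apply_eq_iff_implicitFunction hn hinv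
  rw [nhds_prod_eq] at hiff
  obtain ⟨p, hp, q, hq, hpq⟩ := Filter.eventually_prod_iff.1 hiff
  have hcomp : ContDiffAt ℝ ((r - 1 : ℕ) : ℕ∞) (fun x => F (x, ψ x)) x₀ :=
    hFn.contDiffAt.comp x₀ (contDiffAt_id.prodMk hψ)
  refine hcomp.congr_of_eventuallyEq ?_
  filter_upwards [hp, eventually_exists_maximizer_near hF.continuous hper
    (fun x => (hmax x).imp fun _ h => h.1) ht₀ huniq hq] with x hpx ⟨t, hqt, ht⟩
  have hψt : ψ x = t :=
    (hpq hpx hqt).1 ((hcrit x t ht).trans (hcrit x₀ t₀ ht₀).symm)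
  rw [hψt]
  exact le_antisymm (ciSup_le ht) (le_ciSup ⟨F (x, t), Set.forall_mem_range.2 ht⟩ t)
end

section
/- Let K₁, …, K_s ⊆ ℝ be finitely many sets such that for all i ≠ j the Hausdorff dimension of the product set K_i × K_j (as a subset of ℝ²) is strictly less than 1. Then for every δ > 0 there exist real numbers t₁, …, t_s with |t_i| < δ for all i, such that (K_i + t_i) ∩ (K_j + t_j) = ∅ whenever i ≠ j. -/
open MeasureTheory

/-- The set of differences `x - y` with `(x, y) ∈ A ×ˢ B` is Lebesgue null when
`dimH (A ×ˢ B) < 1`. -/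
lemma volume_sub_image_prod_eq_zero {A B : Set ℝ} (h : dimH (A ×ˢ B) < 1) :
    volume ((fun p : ℝ × ℝ => p.1 - p.2) '' (A ×ˢ B)) = 0 := by
  have hlip : LipschitzWith (1 + 1) (fun p : ℝ × ℝ => p.1 - p.2) :=
    LipschitzWith.prod_fst.sub LipschitzWith.prod_snd
  have hdim := (hlip.dimH_image_le (A ×ˢ B)).trans_lt h
  have hzero := hausdorffMeasure_of_dimH_lt (d := 1) (by simpa using hdim)
  simpa [hausdorffMeasure_real] using hzero

/-- Finitely many parameters can be chosen arbitrarily small so that their pairwise differences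
avoid prescribed null sets. -/
lemma exists_small_sub_notMem_of_null {ι : Type*} (S : Finset ι) (D : ι → ι → Set ℝ)
    (hD : ∀ i j, i ≠ j → volume (D i j) = 0) {δ : ℝ} (hδ : 0 < δ) :
    ∃ t : ι → ℝ, (∀ i, |t i| < δ) ∧
      ∀ i ∈ S, ∀ j ∈ S, i ≠ j → t j - t i ∉ D i j := by
  classical
  induction S using Finset.induction_on with
  | empty => exact ⟨0, fun i => by simpa using hδ, by simp⟩
  | insert a S ha ih =>
    obtain ⟨t, ht, hS⟩ := ih
    have hbad : volume (⋃ i ∈ S, ((fun u => u - t i) ⁻¹' D i a ∪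
        (fun u => t i - u) ⁻¹' D a i)) = 0 := by
      refine (measure_biUnion_null_iff S.countable_toSet).2 fun i hi => ?_
      have hia : i ≠ a := fun e => ha (e ▸ hi)
      refine measure_union_null ?_ ?_
      · exact (measurePreserving_sub_right volume (t i)).quasiMeasurePreserving.preimage_null
          (hD i a hia)
      · exact (quasiMeasurePreserving_sub_left volume (t i)).preimage_null (hD a i hia.symm)
    obtain ⟨u, hu, hgood⟩ : ∃ u ∈ Set.Ioo (-δ) δ, u ∉ ⋃ i ∈ S,
        ((fun u => u - t i) ⁻¹' D i a ∪ (fun u => t i - u) ⁻¹' D a i) := by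
      refine Set.not_subset.1 fun hsub => ?_
      have hnull := measure_mono_null hsub hbad
      rw [Real.volume_Ioo, ENNReal.ofReal_eq_zero] at hnull
      linarith
    simp only [Set.mem_iUnion, Set.mem_union, Set.mem_preimage, not_exists, not_or] at hgood
    refine ⟨Function.update t a u, fun i => ?_, fun i hi j hj hij => ?_⟩
    · rcases eq_or_ne i a with rfl | hia
      · simpa using abs_lt.2 hu
      · simpa [hia] using ht i
    · rcases Finset.mem_insert.1 hi with rfl | hi'
      · have hj' := (Finset.mem_insert.1 hj).resolve_left hij.symm
        simpa [hij.symm] using (hgood j hj').2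
      · have hia : i ≠ a := fun e => ha (e ▸ hi')
        rcases Finset.mem_insert.1 hj with rfl | hj'
        · simpa [hia] using (hgood i hi').1
        · have hja : j ≠ a := fun e => ha (e ▸ hj')
          simpa [hia, hja] using hS i hi' j hj' hij

/-- If `K 1, …, K s ⊆ ℝ` are sets with `dimH (K i × K j) < 1` for all `i ≠ j`, then for every
`δ > 0` one can find translations `t i` with `|t i| < δ` making the translates
`K i + t i` pairwise disjoint. -/
theorem stmt6 (s : ℕ) (K : Fin s → Set ℝ)
    (h : ∀ i j : Fin s, i ≠ j → dimH (K i ×ˢ K j) < 1) :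
    ∀ δ : ℝ, 0 < δ → ∃ t : Fin s → ℝ, (∀ i, |t i| < δ) ∧
      ∀ i j : Fin s, i ≠ j → ((· + t i) '' K i) ∩ ((· + t j) '' K j) = ∅ := by
  intro δ hδ
  obtain ⟨t, ht, hdisj⟩ := exists_small_sub_notMem_of_null Finset.univ
    (fun i j => (fun p : ℝ × ℝ => p.1 - p.2) '' (K i ×ˢ K j))
    (fun i j hij => volume_sub_image_prod_eq_zero (h i j hij)) hδ
  refine ⟨t, ht, fun i j hij => Set.eq_empty_iff_forall_notMem.2 ?_⟩
  rintro _ ⟨⟨x, hx, rfl⟩, y, hy, hxy⟩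
  refine hdisj i (Finset.mem_univ i) j (Finset.mem_univ j) hij ⟨(x, y), ⟨hx, hy⟩, ?_⟩
  dsimp only at hxy ⊢
  linarith
end

section
/- Let M be a metric space, Φ : M → M a homeomorphism, X ⊆ M a nonempty compact set with Φ(X) = X, and F : M → ℝ a continuous function. Then for every x ∈ X there exists y ∈ X such that sup_{n ∈ ℤ} F(Φⁿ(y)) = limsup_{n → ∞} F(Φⁿ(x)). Consequently, the Lagrange spectrum ℒ_{X,Φ,F} is contained in the Markov spectrum ℳ_{X,Φ,F}. -/
open Filter Topology

theorem Homeomorph.continuous_toEquiv_zpow {M : Type*} [TopologicalSpace M] (Φ : Homeomorph M M)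
    (k : ℤ) : Continuous (Φ.toEquiv ^ k : Equiv.Perm M) := by
  have hsymm : Continuous (Φ.toEquiv⁻¹ : Equiv.Perm M) := Φ.symm.continuous
  have hΦ : Continuous (Φ.toEquiv : M → M) := Φ.continuous
  induction k using Int.induction_on with
  | zero => simpa using continuous_id
  | succ n ih =>
    rw [zpow_add_one, Equiv.Perm.coe_mul]
    exact ih.comp hΦ
  | pred n ih =>
    rw [zpow_sub_one, Equiv.Perm.coe_mul]
    exact ih.comp hsymm

theorem Equiv.Perm.zpow_natCast_mem_of_mapsTo {M : Type*} (Φ : Equiv.Perm M) {X : Set M}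
    (hX : Set.MapsTo Φ X X) {x : M} (hx : x ∈ X) (n : ℕ) : (Φ ^ (n : ℤ)) x ∈ X := by
  rw [zpow_natCast, ← Equiv.Perm.iterate_eq_pow]
  exact hX.iterate n hx

theorem Real.mapClusterPt_limsup {α : Type*} {l : Filter α} {u : α → ℝ}
    (h : l.IsBoundedUnder (· ≤ ·) u) (h' : l.IsCoboundedUnder (· ≤ ·) u) :
    MapClusterPt (limsup u l) l u := by
  rw [mapClusterPt_iff_frequently]
  intro s hs
  obtain ⟨ε, hε, hs⟩ := Metric.mem_nhds_iff.1 hs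
  have hlow : ∃ᶠ a in l, limsup u l - ε < u a :=
    frequently_lt_of_lt_limsup h' (by linarith)
  have hupp : ∀ᶠ a in l, u a < limsup u l + ε :=
    eventually_lt_of_limsup_lt (by linarith) h
  refine (hlow.and_eventually hupp).mono fun a ha => hs ?_
  rw [Real.ball_eq_Ioo]
  exact ha

/-- Every Lagrange value on a compact forward invariant set is a Markov value: along an ultrafilter
realizing the limsup, the forward orbit of `x` converges to a suitable point `y`. -/
theorem Homeomorph.exists_iSup_eq_limsup {M : Type*} [TopologicalSpace M] (Φ : Homeomorph M M)
    {X : Set M} (hXc : IsCompact X) (hX : Set.MapsTo Φ X X) {F : M → ℝ} (hF : Continuous F)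
    {x : M} (hx : x ∈ X) :
    ∃ y ∈ X, (⨆ n : ℤ, F ((Φ.toEquiv ^ n) y)) =
      limsup (fun n : ℕ => F ((Φ.toEquiv ^ (n : ℤ)) x)) atTop := by
  set u : ℕ → ℝ := fun n => F ((Φ.toEquiv ^ (n : ℤ)) x) with hu
  have hmem : ∀ n : ℕ, (Φ.toEquiv ^ (n : ℤ)) x ∈ X :=
    Equiv.Perm.zpow_natCast_mem_of_mapsTo Φ.toEquiv hX hx
  obtain ⟨C, hC⟩ := hXc.bddAbove_image hF.continuousOn
  obtain ⟨c, hc⟩ := hXc.bddBelow_image hF.continuousOn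
  have hbdd : atTop.IsBoundedUnder (· ≤ ·) u :=
    isBoundedUnder_of ⟨C, fun n => hC (Set.mem_image_of_mem F (hmem n))⟩
  have hbdd' : atTop.IsBoundedUnder (· ≥ ·) u :=
    isBoundedUnder_of ⟨c, fun n => hc (Set.mem_image_of_mem F (hmem n))⟩
  obtain ⟨U, hU, hUL⟩ := mapClusterPt_iff_ultrafilter.1
    (Real.mapClusterPt_limsup hbdd hbdd'.isCoboundedUnder_le)
  obtain ⟨y, hy, hUy⟩ := hXc.ultrafilter_le_nhds
    (U.map fun n : ℕ => (Φ.toEquiv ^ (n : ℤ)) x)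
    (le_principal_iff.2 (Filter.mem_map.2 (Eventually.of_forall hmem)))
  have hlim : Tendsto (fun n : ℕ => (Φ.toEquiv ^ (n : ℤ)) x) U (𝓝 y) := hUy
  have hFy : F y = limsup u atTop := tendsto_nhds_unique ((hF.tendsto y).comp hlim) hUL
  have hle : ∀ k : ℤ, F ((Φ.toEquiv ^ k) y) ≤ limsup u atTop := by
    intro k
    have hk := ((hF.comp (Φ.continuous_toEquiv_zpow k)).tendsto y).comp hlim
    refine le_of_forall_pos_le_add fun ε hε => le_of_tendsto hk (hU ?_)
    obtain ⟨N, hN⟩ := eventually_atTop.1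
      (eventually_lt_of_limsup_lt (lt_add_of_pos_right (limsup u atTop) hε) hbdd)
    filter_upwards [eventually_ge_atTop (N + k.natAbs)] with n hn
    have hnk : ((k + n).toNat : ℤ) = k + n := Int.toNat_of_nonneg (by omega)
    have hlt := hN (k + n).toNat (by omega)
    simp only [hu, hnk, zpow_add, Equiv.Perm.mul_apply] at hlt
    exact hlt.le
  refine ⟨y, hy, le_antisymm (ciSup_le hle) ?_⟩
  rw [← hFy]
  exact le_ciSup (f := fun n : ℤ => F ((Φ.toEquiv ^ n) y))
    ⟨_, Set.forall_mem_range.2 hle⟩ 0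

/-- For a homeomorphism `Φ` of a metric space, a nonempty compact invariant set `X` and a
continuous `F : M → ℝ`, every Lagrange value `limsup_{n → ∞} F (Φⁿ x)` with `x ∈ X` is the
Markov value `sup_{n ∈ ℤ} F (Φⁿ y)` of some `y ∈ X`; consequently the Lagrange spectrum is
contained in the Markov spectrum. -/
theorem stmt8 {M : Type*} [MetricSpace M] (Φ : Homeomorph M M) (X : Set M)
    (hXne : X.Nonempty) (hXc : IsCompact X) (hXinv : Φ '' X = X)
    (F : M → ℝ) (hF : Continuous F) :
    (∀ x ∈ X, ∃ y ∈ X,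
      (⨆ n : ℤ, F ((Φ.toEquiv ^ n) y)) =
        limsup (fun n : ℕ => F ((Φ.toEquiv ^ (n : ℤ)) x)) atTop) ∧
    {v : ℝ | ∃ x ∈ X, v = limsup (fun n : ℕ => F ((Φ.toEquiv ^ (n : ℤ)) x)) atTop} ⊆
      {v : ℝ | ∃ y ∈ X, v = ⨆ n : ℤ, F ((Φ.toEquiv ^ n) y)} := by
  have key := fun x (hx : x ∈ X) =>
    Φ.exists_iSup_eq_limsup hXc (Set.mapsTo_iff_image_subset.2 hXinv.subset) hF hx
  refine ⟨key, ?_⟩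
  rintro v ⟨x, hx, rfl⟩
  obtain ⟨y, hy, h⟩ := key x hx
  exact ⟨y, hy, h.symm⟩
end

section
/- Let g : ℝ → ℝ be a 1-periodic C² function admitting a point t̃ ∈ ℝ such that g(t̃) = max g, g(t) < g(t̃) for every t with t − t̃ ∉ ℤ, and g''(t̃) < 0. Then there exists ε > 0 such that every 1-periodic C² function h : ℝ → ℝ satisfying sup_x |h(x) − g(x)| < ε, sup_x |h'(x) − g'(x)| < ε and sup_x |h''(x) − g''(x)| < ε also admits a point t̂ ∈ ℝ with h(t̂) = max h, h(t) < h(t̂) for every t with t − t̂ ∉ ℤ, and h''(t̂) < 0. -/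
/-- Openness of the set of `1`-periodic `C²` functions with a unique (mod `1`) nondegenerate
maximum: if `g` has a maximizer `t₀`, unique modulo `1`, with `g'' t₀ < 0`, then every
`1`-periodic `C²` function `h` that is `C²`-close to `g` has the same property. -/
theorem stmt13 (g : ℝ → ℝ) (hg : ContDiff ℝ 2 g) (hper : ∀ t : ℝ, g (t + 1) = g t)
    (t₀ : ℝ) (hmax : ∀ t : ℝ, g t ≤ g t₀)
    (huniq : ∀ t : ℝ, (¬∃ k : ℤ, t - t₀ = (k : ℝ)) → g t < g t₀)
    (hsec : deriv (deriv g) t₀ < 0) :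
    ∃ ε > 0, ∀ h : ℝ → ℝ, ContDiff ℝ 2 h → (∀ t : ℝ, h (t + 1) = h t) →
      (∀ x : ℝ, |h x - g x| < ε) → (∀ x : ℝ, |deriv h x - deriv g x| < ε) →
      (∀ x : ℝ, |deriv (deriv h) x - deriv (deriv g) x| < ε) →
      ∃ t₁ : ℝ, (∀ t : ℝ, h t ≤ h t₁) ∧
        (∀ t : ℝ, (¬∃ k : ℤ, t - t₁ = (k : ℝ)) → h t < h t₁) ∧
        deriv (deriv h) t₁ < 0 := by
  have hcont : Continuous (deriv (deriv g)) := (ContDiff.iterate_deriv' 0 2 hg).continuous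
  obtain ⟨δ, hδ, hδ', hneg⟩ : ∃ δ > 0, δ < 1 / 2 ∧ ∀ x ∈ Set.Icc (t₀ - δ) (t₀ + δ),
      deriv (deriv g) x < deriv (deriv g) t₀ / 2 := by
    have hev : ∀ᶠ x in nhds t₀, deriv (deriv g) x < deriv (deriv g) t₀ / 2 :=
      hcont.continuousAt.eventually_lt continuousAt_const (by linarith)
    obtain ⟨r, hr, hball⟩ := Metric.eventually_nhds_iff.1 hev
    refine ⟨min (r / 2) (1 / 4), by positivity, ?_, fun x hx => hball ?_⟩
    · linarith [min_le_right (r / 2) (1 / 4 : ℝ)]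
    · rw [Real.dist_eq, abs_lt]
      constructor <;> linarith [min_le_left (r / 2) (1 / 4 : ℝ), hx.1, hx.2]
  obtain ⟨s, hs, hsmax⟩ := (isCompact_Icc (a := t₀ + δ) (b := t₀ + 1 - δ)).exists_isMaxOn
    ⟨t₀ + δ, by constructor <;> linarith⟩ hg.continuous.continuousOn
  have hgs : g s < g t₀ := by
    refine huniq s ?_
    rintro ⟨k, hk⟩
    have h0 : (0 : ℝ) < k := by linarith [hs.1]
    have h1 : (k : ℝ) < 1 := by linarith [hs.2]
    norm_cast at h0 h1
    omega
  refine ⟨min (-deriv (deriv g) t₀ / 2) ((g t₀ - g s) / 2),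
    lt_min (by linarith) (by linarith), fun h hh hhper h₀ _ h₂ => ?_⟩
  have hhneg : ∀ x ∈ Set.Icc (t₀ - δ) (t₀ + δ), deriv (deriv h) x < 0 := fun x hx => by
    linarith [(abs_lt.1 (h₂ x)).2, hneg x hx,
      min_le_left (-deriv (deriv g) t₀ / 2) ((g t₀ - g s) / 2)]
  have hconc : StrictConcaveOn ℝ (Set.Icc (t₀ - δ) (t₀ + δ)) h :=
    strictConcaveOn_of_deriv2_neg (convex_Icc _ _) hh.continuous.continuousOn
      fun x hx => hhneg x (interior_subset hx)
  have ht₀ : t₀ ∈ Set.Icc (t₀ - δ) (t₀ + δ) := by constructor <;> linarith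
  obtain ⟨t₁, ht₁, hmax₁⟩ := isCompact_Icc.exists_isMaxOn ⟨t₀, ht₀⟩ hh.continuous.continuousOn
  have hstrict : ∀ t : ℝ, (¬∃ k : ℤ, t - t₁ = (k : ℝ)) → h t < h t₁ := by
    intro t ht
    obtain ⟨k, ⟨hk₁, hk₂⟩, -⟩ := existsUnique_sub_zsmul_mem_Ico one_pos t (t₀ - δ)
    rw [zsmul_one] at hk₁ hk₂
    have hval : h (t - k) = h t := by
      simpa using Function.Periodic.sub_zsmul_eq (f := h) (c := 1) (x := t) hhper k
    rw [← hval]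
    rcases le_or_gt (t - k) (t₀ + δ) with hle | hgt
    · refine lt_of_le_of_ne (hmax₁ ⟨hk₁, hle⟩) fun heq => ht ⟨k, ?_⟩
      have hmax₂ : IsMaxOn h (Set.Icc (t₀ - δ) (t₀ + δ)) (t - k) := fun x hx =>
        (hmax₁ hx).trans heq.ge
      linarith [hconc.eq_of_isMaxOn hmax₂ hmax₁ ⟨hk₁, hle⟩ ht₁]
    · have hgle : g (t - k) ≤ g s := hsmax ⟨hgt.le, by linarith⟩
      have hle₁ : h t₀ ≤ h t₁ := hmax₁ ht₀
      linarith [(abs_lt.1 (h₀ (t - k))).2, (abs_lt.1 (h₀ t₀)).1,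
        min_le_right (-deriv (deriv g) t₀ / 2) ((g t₀ - g s) / 2)]
  refine ⟨t₁, fun t => ?_, hstrict, hhneg t₁ ht₁⟩
  by_cases ht : ∃ k : ℤ, t - t₁ = (k : ℝ)
  · obtain ⟨k, hk⟩ := ht
    have hval : h (t - k) = h t := by
      simpa using Function.Periodic.sub_zsmul_eq (f := h) (c := 1) (x := t) hhper k
    rw [← hval, ← hk, sub_sub_cancel]
  · exact (hstrict t ht).le
end

section
/- Let r ≥ 2 be an integer, let g : ℝ → ℝ be a 1-periodic C^r function, and let ε > 0. Then there exists a 1-periodic C^r function h : ℝ → ℝ with sup_x |h^{(k)}(x) − g^{(k)}(x)| < ε for every 0 ≤ k ≤ r, such that h admits a point t̃ ∈ ℝ with h(t̃) = max h, h(t) < h(t̃) for every t with t − t̃ ∉ ℤ, and h''(t̃) < 0. -/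
/-- The second derivative of a function is nonpositive at a point of local maximum. -/
lemma IsLocalMax.deriv_deriv_nonpos {f : ℝ → ℝ} {a : ℝ} (h : IsLocalMax f a)
    (hf : ContinuousAt f a) : deriv (deriv f) a ≤ 0 := by
  by_contra! hpos
  have hmin : IsLocalMin f a := isLocalMin_of_deriv_deriv_pos hpos h.deriv_eq_zero hf
  have hconst : f =ᶠ[nhds a] fun _ ↦ f a := by
    filter_upwards [h, hmin] with x h₁ h₂ using le_antisymm h₁ h₂
  have hzero : deriv (deriv f) a = 0 := by
    rw [hconst.deriv.deriv_eq]
    simp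
  exact hpos.ne' hzero

/-- A continuous periodic function on the real line attains its maximum. -/
lemma Function.Periodic.exists_forall_le {f : ℝ → ℝ} {c : ℝ} (hp : Function.Periodic f c)
    (hc : c ≠ 0) (hf : Continuous f) : ∃ a, ∀ x, f x ≤ f a := by
  obtain ⟨_, ⟨a, rfl⟩, ha⟩ :=
    (hp.compact_of_continuous hc hf).exists_isGreatest (Set.range_nonempty f)
  exact ⟨a, fun x ↦ ha ⟨x, rfl⟩⟩

lemma iteratedDeriv_const_mul_cos_mul_sub (k : ℕ) (δ c a x : ℝ) :
    iteratedDeriv k (fun t ↦ δ * Real.cos (c * (t - a))) x =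
      δ * (c ^ k * iteratedDeriv k Real.cos (c * (x - a))) := by
  rw [iteratedDeriv_const_mul_field,
    iteratedDeriv_comp_sub_const k (fun t ↦ Real.cos (c * t)) a,
    iteratedDeriv_comp_const_mul Real.contDiff_cos]

/-- Density of `1`-periodic `C^r` functions with a unique (mod `1`) nondegenerate maximum:
any `1`-periodic `C^r` function `g` (`r ≥ 2`) can be approximated, uniformly in all derivatives
up to order `r`, by a `1`-periodic `C^r` function `h` admitting a maximizer `t₀`, unique
modulo `1`, with `h'' t₀ < 0`. -/
theorem stmt14 (r : ℕ) (hr : 2 ≤ r) (g : ℝ → ℝ) (hg : ContDiff ℝ r g)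
    (hper : ∀ t : ℝ, g (t + 1) = g t) (ε : ℝ) (hε : 0 < ε) :
    ∃ h : ℝ → ℝ, ContDiff ℝ r h ∧ (∀ t : ℝ, h (t + 1) = h t) ∧
      (∀ k ≤ r, ∀ x : ℝ, |iteratedDeriv k h x - iteratedDeriv k g x| < ε) ∧
      ∃ t₀ : ℝ, (∀ t : ℝ, h t ≤ h t₀) ∧
        (∀ t : ℝ, (¬∃ k : ℤ, t - t₀ = (k : ℝ)) → h t < h t₀) ∧
        deriv (deriv h) t₀ < 0 := by
  obtain ⟨a, ha⟩ := Function.Periodic.exists_forall_le hper one_ne_zero hg.continuous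
  have hc : 1 ≤ 2 * Real.pi := by linarith [Real.pi_gt_three]
  set M : ℝ := (2 * Real.pi) ^ r
  have hMpos : 0 < M := by positivity
  set δ : ℝ := ε / (2 * M) with hδ
  have hδpos : 0 < δ := by positivity
  set p : ℝ → ℝ := fun t ↦ δ * Real.cos (2 * Real.pi * (t - a)) with hp
  have hpsmooth (n : ℕ) : ContDiff ℝ n p := by fun_prop
  have hadd (k : ℕ) (hk : k ≤ r) (x : ℝ) : iteratedDeriv k (fun t ↦ g t + p t) x =
      iteratedDeriv k g x + iteratedDeriv k p x :=
    iteratedDeriv_fun_add (hg.of_le (by exact_mod_cast hk)).contDiffAt (hpsmooth k).contDiffAt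
  refine ⟨fun t ↦ g t + p t, hg.add (hpsmooth r), fun t ↦ ?_, fun k hk x ↦ ?_, a, fun t ↦ ?_,
    fun t ht ↦ ?_, ?_⟩
  · have hcos : 2 * Real.pi * (t + 1 - a) = 2 * Real.pi * (t - a) + 2 * Real.pi := by ring
    simp only [hp, hper, hcos, Real.cos_add_two_pi]
  · rw [hadd k hk, add_sub_cancel_left, hp, iteratedDeriv_const_mul_cos_mul_sub, abs_mul,
      abs_mul, abs_of_pos hδpos, abs_of_pos (by positivity)]
    calc δ * ((2 * Real.pi) ^ k * |iteratedDeriv k Real.cos (2 * Real.pi * (x - a))|)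
        ≤ δ * (M * 1) := by
          gcongr
          · exact pow_le_pow_right₀ hc hk
          · exact Real.abs_iteratedDeriv_cos_le_one k _
      _ = ε / 2 := by rw [hδ]; field_simp
      _ < ε := half_lt_self hε
  · have := mul_le_mul_of_nonneg_left (Real.cos_le_one (2 * Real.pi * (t - a))) hδpos.le
    simpa [hp] using add_le_add (ha t) this
  · have hne : Real.cos (2 * Real.pi * (t - a)) ≠ 1 := fun h ↦ by
      obtain ⟨n, hn⟩ := (Real.cos_eq_one_iff _).1 h
      exact ht ⟨n, mul_left_cancel₀ Real.two_pi_pos.ne' (by linarith)⟩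
    have := mul_lt_mul_of_pos_left ((Real.cos_le_one _).lt_of_ne hne) hδpos
    simpa [hp] using add_lt_add_of_le_of_lt (ha t) this
  · have hg2 : deriv (deriv g) a ≤ 0 :=
      IsLocalMax.deriv_deriv_nonpos (Filter.Eventually.of_forall ha) hg.continuous.continuousAt
    have h2 := hadd 2 hr a
    rw [hp, iteratedDeriv_const_mul_cos_mul_sub] at h2
    simp only [iteratedDeriv_succ, iteratedDeriv_zero] at h2
    rw [h2]
    have hpos : 0 < δ * (2 * Real.pi) ^ 2 := by positivity
    simp only [sub_self, mul_zero, Real.deriv_cos', deriv.fun_neg, Real.deriv_sin, Real.cos_zero]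
    linarith
end

section
/- Let M be a metric space, Φ : M → M a homeomorphism, X ⊆ M a nonempty compact set with Φ(X) = X, and F : M → ℝ a Lipschitz function. Then the Hausdorff dimensions of the Lagrange spectrum ℒ_{X,Φ,F} and of the Markov spectrum ℳ_{X,Φ,F} are both at most the Hausdorff dimension of X. -/
open Filter

/-- A closed set which contains a bounded real sequence contains its upper limit. -/
theorem IsClosed.limsup_mem_of_bounded {K : Set ℝ} (hK : IsClosed K) (hb : Bornology.IsBounded K)
    {u : ℕ → ℝ} (hu : ∀ n, u n ∈ K) : limsup u atTop ∈ K := by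
  obtain ⟨B, hB⟩ := hb.bddAbove
  obtain ⟨b, h_b⟩ := hb.bddBelow
  have hle : IsBoundedUnder (· ≤ ·) atTop u := isBoundedUnder_of ⟨B, fun n => hB (hu n)⟩
  have hge : IsBoundedUnder (· ≥ ·) atTop u := isBoundedUnder_of ⟨b, fun n => h_b (hu n)⟩
  rw [← hK.closure_eq, Metric.mem_closure_iff]
  intro ε hε
  have h1 : ∃ᶠ n in atTop, limsup u atTop - ε < u n :=
    frequently_lt_of_lt_limsup hge.isCoboundedUnder_le (by linarith)
  have h2 : ∀ᶠ n in atTop, u n < limsup u atTop + ε :=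
    eventually_lt_of_limsup_lt (by linarith) hle
  obtain ⟨n, hn1, hn2⟩ := (h1.and_eventually h2).exists
  refine ⟨u n, hu n, ?_⟩
  rw [Real.dist_eq, abs_lt]
  constructor <;> linarith

/-- Integer powers of a permutation preserve each set that equals its own image. -/
theorem Equiv.Perm.zpow_apply_mem_of_image_eq {α : Type*} (e : Equiv.Perm α) {s : Set α}
    (hs : e '' s = s) {x : α} (hx : x ∈ s) (n : ℤ) : (e ^ n) x ∈ s := by
  have hpos : ∀ y ∈ s, e y ∈ s := fun y hy => hs ▸ Set.mem_image_of_mem e hy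
  have hneg : ∀ y ∈ s, e⁻¹ y ∈ s := by
    intro y hy
    rw [← hs] at hy
    obtain ⟨z, hz, rfl⟩ := hy
    simpa using hz
  induction n using Int.induction_on with
  | zero => simpa using hx
  | succ k ih =>
    rw [add_comm, zpow_add, zpow_one]
    exact hpos _ ih
  | pred k ih =>
    rw [sub_eq_neg_add, zpow_add, zpow_neg_one]
    exact hneg _ ih

/-- For a homeomorphism `Φ` of a metric space, a nonempty compact invariant set `X` and a
Lipschitz function `F : M → ℝ`, the Hausdorff dimensions of the Lagrange spectrum
`{limsup_{n → ∞} F (Φⁿ x) : x ∈ X}` and of the Markov spectrum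
`{sup_{n ∈ ℤ} F (Φⁿ x) : x ∈ X}` are at most `dimH X`. -/
theorem stmt15 {M : Type*} [MetricSpace M] (Φ : Homeomorph M M) (X : Set M)
    (hXne : X.Nonempty) (hXc : IsCompact X) (hXinv : Φ '' X = X)
    (F : M → ℝ) (hF : ∃ K : NNReal, LipschitzWith K F) :
    dimH {v : ℝ | ∃ x ∈ X, v = limsup (fun n : ℕ => F ((Φ.toEquiv ^ (n : ℤ)) x)) atTop} ≤
        dimH X ∧
    dimH {v : ℝ | ∃ x ∈ X, v = ⨆ n : ℤ, F ((Φ.toEquiv ^ n) x)} ≤ dimH X := by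
  obtain ⟨K, hFK⟩ := hF
  have hFX : IsCompact (F '' X) := hXc.image hFK.continuous
  have orbit_mem : ∀ x ∈ X, ∀ n : ℤ, F ((Φ.toEquiv ^ n) x) ∈ F '' X := fun x hx n =>
    Set.mem_image_of_mem F (Equiv.Perm.zpow_apply_mem_of_image_eq Φ.toEquiv hXinv hx n)
  have hdim : dimH (F '' X) ≤ dimH X := hFK.dimH_image_le X
  constructor
  · refine (dimH_mono ?_).trans hdim
    rintro _ ⟨x, hx, rfl⟩
    exact hFX.isClosed.limsup_mem_of_bounded hFX.isBounded fun n => orbit_mem x hx n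
  · refine (dimH_mono ?_).trans hdim
    rintro _ ⟨x, hx, rfl⟩
    have hsub : Set.range (fun n : ℤ => F ((Φ.toEquiv ^ n) x)) ⊆ F '' X :=
      Set.range_subset_iff.2 (orbit_mem x hx)
    exact closure_minimal hsub hFX.isClosed
      (csSup_mem_closure (Set.range_nonempty _) (hFX.bddAbove.mono hsub))
end
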